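/- arXiv:1108.4751 — 2 statements merged into one kernel-verified Lean document; each statement's English description precedes it below -/
import Mathlib

section
/- Every family L of seven distinct 2-element subsets of {1,…,6} contains a complementary pair or a disjoint triple; that is, either there exist distinct colors a, b, c, d with {a,b}, {c,d}, {a,c}, {b,d} all in L, or there exist distinct colors a, b, c, d, e, f with {a,b}, {c,d}, {e,f} all in L. -/
def lblSearch : List ℕ → List (List ℕ) → ℕ → Bool
  | [], cs, k => !(Nat.beq k 0) || cs.any List.isEmpty
  | x :: xs, cs, k =>
    cs.any List.isEmpty || Nat.blt (xs.length + 1) k ||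
      (lblSearch xs (cs.map (List.filter fun y => !(Nat.beq y x))) (k - 1) &&
       lblSearch xs (cs.filter (List.all · fun y => !(Nat.beq y x))) k)

theorem lblSearch_empty (p : ℕ → Bool) (cs : List (List ℕ))
    (h : cs.any List.isEmpty = true) : ∃ c ∈ cs, ∀ x ∈ c, p x = true := by
  obtain ⟨c, hc, h⟩ := List.any_eq_true.1 h
  refine ⟨c, hc, ?_⟩
  rw [List.isEmpty_iff] at h
  simp [h]

theorem lblSearch_sound (p : ℕ → Bool) : ∀ (xs : List ℕ) (cs : List (List ℕ)) (k : ℕ),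
    xs.countP p = k → lblSearch xs cs k = true → ∃ c ∈ cs, ∀ x ∈ c, p x = true
  | [], cs, k, hk, h => by
    simp only [List.countP_nil] at hk
    subst hk
    apply lblSearch_empty
    simpa [lblSearch] using h
  | x :: xs, cs, k, hk, h => by
    rw [lblSearch, Bool.or_eq_true, Bool.or_eq_true, Bool.and_eq_true] at h
    rcases h with (h | h) | ⟨h1, h2⟩
    · exact lblSearch_empty p cs h
    · have := List.countP_le_length (p := p) (l := x :: xs)
      simp only [Nat.blt_eq, List.length_cons] at h this
      omega
    · rw [List.countP_cons] at hk
      by_cases hx : p x = true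
      · simp only [hx, if_true] at hk
        obtain ⟨c, hc, hp⟩ := lblSearch_sound p xs _ _ (by omega) h1
        obtain ⟨d, hd, rfl⟩ := List.mem_map.1 hc
        refine ⟨d, hd, fun y hy => ?_⟩
        by_cases hyx : y = x
        · rw [hyx, hx]
        · exact hp y (List.mem_filter.2 ⟨hy, by
            rw [Bool.not_eq_true', ← Bool.not_eq_true, Nat.beq_eq]; exact hyx⟩)
      · simp only [hx] at hk
        obtain ⟨c, hc, hp⟩ := lblSearch_sound p xs _ _ (by simpa using hk) h2
        exact ⟨c, (List.mem_filter.1 hc).1, hp⟩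

def lblEnc (a b : ℕ) : ℕ := if a < b then 10 * a + b else 10 * b + a
def lblDec (e : ℕ) : Finset ℕ := {e / 10, e % 10}

theorem lblDec_enc (a b : ℕ) (ha : a ≤ 6) (hb : b ≤ 6) : lblDec (lblEnc a b) = {a, b} := by
  unfold lblDec lblEnc
  split_ifs
  · rw [show (10 * a + b) / 10 = a by omega, show (10 * a + b) % 10 = b by omega]
  · rw [show (10 * b + a) / 10 = b by omega, show (10 * b + a) % 10 = a by omega,
      Finset.pair_comm]

def lblCyc : List (List ℕ) :=
  [1, 2, 3].flatMap fun a => [2, 3, 4, 5].flatMap fun b => [3, 4, 5, 6].flatMap fun c =>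
    [2, 3, 4, 5, 6].flatMap fun d =>
      if a < b ∧ b < c ∧ a < d ∧ d ≠ b ∧ d ≠ c then
        [[lblEnc a b, lblEnc c d, lblEnc a c, lblEnc b d]] else []

def lblMat : List (List ℕ) :=
  [2, 3, 4, 5, 6].flatMap fun b => [2, 3].flatMap fun c =>
    [3, 4, 5, 6].flatMap fun d => [3, 4, 5].flatMap fun e => [4, 5, 6].flatMap fun f =>
      if c < d ∧ e < f ∧ c < e ∧ b ≠ c ∧ b ≠ d ∧ b ≠ e ∧ b ≠ f ∧ d ≠ e ∧ d ≠ f then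
        [[lblEnc 1 b, lblEnc c d, lblEnc e f]] else []

def lblEdges : List ℕ := [12, 13, 14, 15, 16, 23, 24, 25, 26, 34, 35, 36, 45, 46, 56]

theorem lblSearch_run : lblSearch lblEdges (lblMat ++ lblCyc) 7 = true := by decide +kernel

theorem lblEdges_count (L : Finset (Finset ℕ)) (hcard : L.card = 7)
    (hL : ∀ A ∈ L, A.card = 2 ∧ A ⊆ Finset.Icc 1 6) :
    lblEdges.countP (fun e => decide (lblDec e ∈ L)) = 7 := by
  have hnd : (lblEdges.map lblDec).Nodup := by decide +kernel
  have hall : ∀ A ∈ Finset.powersetCard 2 (Finset.Icc 1 6), A ∈ lblEdges.map lblDec := by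
    decide +kernel
  have h2 : L = ((lblEdges.map lblDec).filter (fun A => decide (A ∈ L))).toFinset := by
    ext A
    rw [List.mem_toFinset, List.mem_filter, decide_eq_true_iff]
    exact ⟨fun h => ⟨hall A (Finset.mem_powersetCard.2 ⟨(hL A h).2, (hL A h).1⟩), h⟩,
      fun h => h.2⟩
  have h3 := List.toFinset_card_of_nodup (hnd.filter (fun A => decide (A ∈ L)))
  rw [← h2, hcard, ← List.countP_eq_length_filter, List.countP_map] at h3
  exact h3.symm


theorem seven_labels_contain_complementary_pair_or_disjoint_triple
    (L : Finset (Finset ℕ)) (hcard : L.card = 7)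
    (hL : ∀ A ∈ L, A.card = 2 ∧ A ⊆ Finset.Icc 1 6) :
    (∃ a b c d : ℕ, a ∈ Finset.Icc 1 6 ∧ b ∈ Finset.Icc 1 6 ∧
      c ∈ Finset.Icc 1 6 ∧ d ∈ Finset.Icc 1 6 ∧
      ({a, b, c, d} : Finset ℕ).card = 4 ∧
      {a, b} ∈ L ∧ {c, d} ∈ L ∧ {a, c} ∈ L ∧ {b, d} ∈ L) ∨
    (∃ a b c d e f : ℕ, a ∈ Finset.Icc 1 6 ∧ b ∈ Finset.Icc 1 6 ∧
      c ∈ Finset.Icc 1 6 ∧ d ∈ Finset.Icc 1 6 ∧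
      e ∈ Finset.Icc 1 6 ∧ f ∈ Finset.Icc 1 6 ∧
      ({a, b, c, d, e, f} : Finset ℕ).card = 6 ∧
      {a, b} ∈ L ∧ {c, d} ∈ L ∧ {e, f} ∈ L) := by
  obtain ⟨l, hl, hp⟩ := lblSearch_sound (fun e => decide (lblDec e ∈ L)) _ _ _
    (lblEdges_count L hcard hL) lblSearch_run
  rcases List.mem_append.1 hl with hl | hl
  · right
    simp only [lblMat, List.mem_flatMap] at hl
    obtain ⟨b, hb, c, hc, d, hd, e, he, f, hf, h⟩ := hl
    split_ifs at h with hh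
    · rw [List.mem_singleton] at h
      subst h
      simp only [List.mem_cons, List.not_mem_nil, or_false] at hb hc hd he hf
      simp only [List.mem_cons, List.not_mem_nil, or_false, forall_eq_or_imp, forall_eq,
        decide_eq_true_eq] at hp
      rw [lblDec_enc _ _ (by omega) (by omega), lblDec_enc _ _ (by omega) (by omega),
        lblDec_enc _ _ (by omega) (by omega)] at hp
      refine ⟨1, b, c, d, e, f, ?_, ?_, ?_, ?_, ?_, ?_, ?_, hp.1, hp.2.1, hp.2.2⟩
      iterate 6 (rw [Finset.mem_Icc]; omega)
      repeat rw [Finset.card_insert_of_notMem (by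
        simp only [Finset.mem_insert, Finset.mem_singleton]; omega)]
      simp
    · simp at h
  · left
    simp only [lblCyc, List.mem_flatMap] at hl
    obtain ⟨a, ha, b, hb, c, hc, d, hd, h⟩ := hl
    split_ifs at h with hh
    · rw [List.mem_singleton] at h
      subst h
      simp only [List.mem_cons, List.not_mem_nil, or_false] at ha hb hc hd
      simp only [List.mem_cons, List.not_mem_nil, or_false, forall_eq_or_imp, forall_eq,
        decide_eq_true_eq] at hp
      rw [lblDec_enc _ _ (by omega) (by omega), lblDec_enc _ _ (by omega) (by omega),
        lblDec_enc _ _ (by omega) (by omega), lblDec_enc _ _ (by omega) (by omega)] at hp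
      refine ⟨a, b, c, d, ?_, ?_, ?_, ?_, ?_, hp⟩
      iterate 4 (rw [Finset.mem_Icc]; omega)
      repeat rw [Finset.card_insert_of_notMem (by
        simp only [Finset.mem_insert, Finset.mem_singleton]; omega)]
      simp
    · simp at h
end

section
/- In any 2-tone 6-coloring of the Heawood graph, there do not exist three vertices lying in the same partite set of the bipartition whose labels are three pairwise disjoint 2-element subsets of {1,…,6}. -/
/-- A `t`-tone `k`-coloring of a simple graph `G` assigns to each vertex a `t`-element
subset of `{1, …, k}` so that any two distinct vertices `u`, `v` share fewer than
`d(u,v)` colors (vertices at infinite distance impose no constraint). -/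
def IsTToneColoring {V : Type*} (G : SimpleGraph V) (t k : ℕ) (f : V → Finset ℕ) : Prop :=
  (∀ v, (f v).card = t ∧ f v ⊆ Finset.Icc 1 k) ∧
  ∀ u v : V, u ≠ v → ((f u ∩ f v).card : ℕ∞) < G.edist u v

/-- The `t`-tone chromatic number: the least `k` admitting a `t`-tone `k`-coloring. -/
noncomputable def toneNumber {V : Type*} (G : SimpleGraph V) (t : ℕ) : ℕ :=
  sInf {k | ∃ f : V → Finset ℕ, IsTToneColoring G t k f}
/-- The Heawood graph on vertex set `ℤ/14ℤ`: each `i` is adjacent to `i + 1` and `i - 1`,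
and each even `i` is adjacent to `i + 5`. -/
def heawoodGraph : SimpleGraph (ZMod 14) :=
  SimpleGraph.fromRel (fun i j => j = i + 1 ∨ (Even i.val ∧ j = i + 5))

lemma hw_core (A B C D E F G L1 L2 L3 M1 M2 M3 : Finset ℕ)
    (hA : A.card = 2) (hB : B.card = 2) (hC : C.card = 2) (hD : D.card = 2) (hE : E.card = 2)
    (hF : F.card = 2) (hG : G.card = 2) (h1 : L1.card = 2) (h2 : L2.card = 2) (h3 : L3.card = 2)
    (k1 : M1.card = 2) (k2 : M2.card = 2) (k3 : M3.card = 2)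
    (sub : ∀ X ∈ [A, B, C, D, E, F, G, L1, L2, L3, M1, M2, M3], X ⊆ Finset.Icc 1 6)
    (AB : Disjoint A B) (AC : Disjoint A C) (BC : Disjoint B C)
    (a1 : Disjoint L1 A) (a2 : Disjoint L1 B) (a3 : Disjoint L1 D)
    (b1 : Disjoint L2 B) (b2 : Disjoint L2 C) (b3 : Disjoint L2 E)
    (c1 : Disjoint L3 A) (c2 : Disjoint L3 C) (c3 : Disjoint L3 F)
    (d1 : Disjoint M1 A) (d2 : Disjoint M1 E) (d3 : Disjoint M1 G)
    (e1 : Disjoint M2 B) (e2 : Disjoint M2 F) (e3 : Disjoint M2 G)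
    (f1 : Disjoint M3 C) (f2 : Disjoint M3 D) (f3 : Disjoint M3 G)
    (GD : G ≠ D) (GE : G ≠ E) (GF : G ≠ F) : False := by
  simp only [List.mem_cons, List.not_mem_nil, or_false, forall_eq_or_imp, forall_eq] at sub
  obtain ⟨sA, sB, sC, sD, sE, sF, sG, s1, s2, s3, t1, t2, t3⟩ := sub
  -- three pairwise disjoint pairs cover everything
  have cover : ∀ X Y Z : Finset ℕ, X.card = 2 → Y.card = 2 → Z.card = 2 →
      X ⊆ Finset.Icc 1 6 → Y ⊆ Finset.Icc 1 6 → Z ⊆ Finset.Icc 1 6 →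
      Disjoint X Y → Disjoint X Z → Disjoint Y Z →
      ∀ W : Finset ℕ, W ⊆ Finset.Icc 1 6 → ∀ x ∈ W, x ∈ X ∨ x ∈ Y ∨ x ∈ Z := by
    intro X Y Z hX hY hZ sX sY sZ XY XZ YZ W hW x hx
    have hc : (X ∪ (Y ∪ Z)).card = 6 := by
      rw [Finset.card_union_of_disjoint (Finset.disjoint_union_right.2 ⟨XY, XZ⟩),
        Finset.card_union_of_disjoint YZ, hX, hY, hZ]
    have he : X ∪ (Y ∪ Z) = Finset.Icc 1 6 :=
      Finset.eq_of_subset_of_card_le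
        (Finset.union_subset sX (Finset.union_subset sY sZ)) (by rw [hc]; simp)
    have := hW hx
    rw [← he] at this
    simpa using this
  -- two disjoint pairs avoided by both `L` and `Z` force `L = Z`
  have third : ∀ X Y Z L : Finset ℕ, X.card = 2 → Y.card = 2 → Z.card = 2 → L.card = 2 →
      X ⊆ Finset.Icc 1 6 → Y ⊆ Finset.Icc 1 6 → Z ⊆ Finset.Icc 1 6 → L ⊆ Finset.Icc 1 6 →
      Disjoint X Y → Disjoint X Z → Disjoint Y Z → Disjoint L X → Disjoint L Y → L = Z := by
    intro X Y Z L hX hY hZ hL sX sY sZ sL XY XZ YZ LX LY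
    refine Finset.eq_of_subset_of_card_le (fun x hx => ?_) (by omega)
    rcases cover X Y Z hX hY hZ sX sY sZ XY XZ YZ L sL x hx with h | h | h
    · exact absurd h (Finset.disjoint_left.1 LX hx)
    · exact absurd h (Finset.disjoint_left.1 LY hx)
    · exact h
  have q1 := third A B C L1 hA hB hC h1 sA sB sC s1 AB AC BC a1 a2
  have q2 := third B C A L2 hB hC hA h2 sB sC sA s2 BC AB.symm AC.symm b1 b2
  have q3 := third A C B L3 hA hC hB h3 sA sC sB s3 AC AB BC.symm c1 c2
  subst q1 q2 q3
  have g1 := cover M1 _ E k1 hA hE t1 sA sE d1 d2 b3 G sG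
  have g2 := cover M2 _ F k2 hB hF t2 sB sF e1 e2 c3 G sG
  have g3 := cover M3 _ D k3 hC hD t3 sC sD f1 f2 a3 G sG
  have g0 := cover _ _ _ hA hB hC sA sB sC AB AC BC G sG
  have key : G ⊆ D ∨ G ⊆ E ∨ G ⊆ F := by
    have pt : ∀ x ∈ G, (x ∈ E ∧ x ∈ F) ∨ (x ∈ F ∧ x ∈ D) ∨ (x ∈ E ∧ x ∈ D) := by
      intro x hx
      have x0 := g0 x hx
      have x1 := (g1 x hx).resolve_left (Finset.disjoint_right.1 d3 hx)
      have x2 := (g2 x hx).resolve_left (Finset.disjoint_right.1 e3 hx)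
      have x3 := (g3 x hx).resolve_left (Finset.disjoint_right.1 f3 hx)
      have n1 := fun h : x ∈ _ => Finset.disjoint_left.1 AB h
      have n2 := fun h : x ∈ _ => Finset.disjoint_left.1 AC h
      have n3 := fun h : x ∈ _ => Finset.disjoint_left.1 BC h
      clear * - x0 x1 x2 x3 n1 n2 n3
      tauto
    obtain ⟨x, y, -, rfl⟩ := Finset.card_eq_two.1 hG
    simp only [Finset.insert_subset_iff, Finset.singleton_subset_iff]
    have hx := pt x (by simp)
    have hy := pt y (by simp)
    clear * - hx hy
    tauto
  rcases key with h | h | h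
  · exact GD (Finset.eq_of_subset_of_card_le h (by omega))
  · exact GE (Finset.eq_of_subset_of_card_le h (by omega))
  · exact GF (Finset.eq_of_subset_of_card_le h (by omega))

/-- Boolean adjacency of the Heawood graph. -/
def hwAdj (i j : Fin 14) : Bool :=
  let d := (j.val + 14 - i.val) % 14
  d == 1 || d == 13 || (if i.val % 2 == 0 then d == 5 else d == 9)

lemma hwAdj_adj : ∀ i j : Fin 14, hwAdj i j = true →
    i ≠ j ∧ ((j = i + 1 ∨ (i.val % 2 = 0 ∧ j = i + 5)) ∨
      (i = j + 1 ∨ (j.val % 2 = 0 ∧ i = j + 5))) := by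
  decide +kernel

lemma hw_adj {i j : ZMod 14} (h : hwAdj i j = true) : heawoodGraph.Adj i j := by
  have := hwAdj_adj i j h
  simp only [heawoodGraph, SimpleGraph.fromRel_adj, Nat.even_iff]
  exact this

lemma hw_common : ∀ a b : Fin 14, a.val % 2 = b.val % 2 →
    ∃ l : Fin 14, hwAdj l a = true ∧ hwAdj l b = true := by
  decide +kernel

/-- The lines through the seventh point, and that point. -/
def HwInner (a b c d e f : Fin 14) : Prop :=
    ∃ m1 : Fin 14, (hwAdj m1 a = true ∧ hwAdj m1 e = true) ∧
    ∃ m2 : Fin 14, (hwAdj m2 b = true ∧ hwAdj m2 f = true) ∧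
    ∃ m3 : Fin 14, (hwAdj m3 c = true ∧ hwAdj m3 d = true) ∧
    ∃ g : Fin 14, hwAdj m1 g = true ∧ hwAdj m2 g = true ∧ hwAdj m3 g = true ∧
      (g ≠ d ∧ g ≠ e ∧ g ≠ f) ∧ g.val % 2 = d.val % 2 ∧ g.val % 2 = e.val % 2 ∧
      g.val % 2 = f.val % 2

instance (a b c d e f : Fin 14) : Decidable (HwInner a b c d e f) := by
  unfold HwInner
  repeat' first
    | refine @Nat.decidableExistsFin 14 _ (fun _ => ?_)
    | refine @instDecidableAnd _ _ ?_ ?_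
    | infer_instance

/-- The sides of the triangle with their third points. -/
def HwOuter (a b c : Fin 14) : Prop :=
    ∃ l1 : Fin 14, (hwAdj l1 a = true ∧ hwAdj l1 b = true) ∧
    ∃ l2 : Fin 14, (hwAdj l2 b = true ∧ hwAdj l2 c = true) ∧
    ∃ l3 : Fin 14, (hwAdj l3 a = true ∧ hwAdj l3 c = true) ∧
    ∃ d : Fin 14, (hwAdj l1 d = true ∧ d ≠ a ∧ d ≠ b) ∧
    ∃ e : Fin 14, (hwAdj l2 e = true ∧ e ≠ b ∧ e ≠ c) ∧
    ∃ f : Fin 14, (hwAdj l3 f = true ∧ f ≠ a ∧ f ≠ c) ∧ HwInner a b c d e f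

instance (a b c : Fin 14) : Decidable (HwOuter a b c) := by
  unfold HwOuter
  repeat' first
    | refine @Nat.decidableExistsFin 14 _ (fun _ => ?_)
    | refine @instDecidableAnd _ _ ?_ ?_
    | infer_instance

lemma hw_config : ∀ a b : Fin 14, a ≠ b → a.val % 2 = b.val % 2 → ∀ c : Fin 14,
    a ≠ c → b ≠ c → a.val % 2 = c.val % 2 →
    (∃ l : Fin 14, hwAdj l a = true ∧ hwAdj l b = true ∧ hwAdj l c = true) ∨
    HwOuter a b c := by
  decide +kernel

lemma hw_disj {f : ZMod 14 → Finset ℕ} (hf : IsTToneColoring heawoodGraph 2 6 f)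
    {i j : ZMod 14} (h : hwAdj i j = true) : Disjoint (f i) (f j) := by
  have ha := hw_adj h
  have := hf.2 i j ha.ne
  rw [SimpleGraph.edist_eq_one_iff_adj.2 ha] at this
  have h0 : (f i ∩ f j).card < 1 := by exact_mod_cast this
  rw [Finset.disjoint_iff_inter_eq_empty, ← Finset.card_eq_zero]
  omega

lemma hw_ne {f : ZMod 14 → Finset ℕ} (hf : IsTToneColoring heawoodGraph 2 6 f)
    {i j : Fin 14} (hne : i ≠ j) (h : i.val % 2 = j.val % 2) : f i ≠ f j := by
  intro he
  obtain ⟨l, h1, h2⟩ := hw_common i j h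
  have hle : heawoodGraph.edist i j ≤ 2 :=
    SimpleGraph.Walk.edist_le (.cons (hw_adj h1).symm (.cons (hw_adj h2) .nil))
  have := (hf.2 i j hne).trans_le hle
  rw [← he, Finset.inter_self, (hf.1 i).1] at this
  exact absurd this (by simp)

theorem heawood_no_disjoint_triple_in_partite_set
    (f : ZMod 14 → Finset ℕ) (hf : IsTToneColoring heawoodGraph 2 6 f) :
    ¬ ∃ v₁ v₂ v₃ : ZMod 14,
      v₁ ≠ v₂ ∧ v₁ ≠ v₃ ∧ v₂ ≠ v₃ ∧
      ((Even v₁.val ∧ Even v₂.val ∧ Even v₃.val) ∨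
        (¬ Even v₁.val ∧ ¬ Even v₂.val ∧ ¬ Even v₃.val)) ∧
      Disjoint (f v₁) (f v₂) ∧ Disjoint (f v₁) (f v₃) ∧ Disjoint (f v₂) (f v₃) := by
  rintro ⟨a, b, c, hab, hac, hbc, hpar, AB, AC, BC⟩
  have p : (a : Fin 14).val % 2 = (b : Fin 14).val % 2 ∧
      (a : Fin 14).val % 2 = (c : Fin 14).val % 2 := by
    simp only [Nat.even_iff] at hpar
    omega
  have cd := fun v => (hf.1 v).1
  have sb := fun v => (hf.1 v).2
  rcases hw_config a b hab p.1 c hac hbc p.2 with ⟨l, la, lb, lc⟩ |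
    ⟨l1, ⟨u1, u2⟩, l2, ⟨u3, u4⟩, l3, ⟨u5, u6⟩, d, ⟨u7, -, -⟩, e, ⟨u8, -, -⟩, g, ⟨u9, -, -⟩,
      m1, ⟨w1, w2⟩, m2, ⟨w3, w4⟩, m3, ⟨w5, w6⟩, z, x1, x2, x3, ⟨y1, y2, y3⟩, z1, z2, z3⟩
  · have hu : (f l ∪ (f a ∪ (f b ∪ f c))).card = 8 := by
      rw [Finset.card_union_of_disjoint, Finset.card_union_of_disjoint,
        Finset.card_union_of_disjoint BC, cd, cd, cd]
      · exact congrArg (· + 6) (cd l)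
      · exact Finset.disjoint_union_right.2 ⟨AB, AC⟩
      · exact Finset.disjoint_union_right.2 ⟨hw_disj hf la,
          Finset.disjoint_union_right.2 ⟨hw_disj hf lb, hw_disj hf lc⟩⟩
    have hs : f l ∪ (f a ∪ (f b ∪ f c)) ⊆ Finset.Icc 1 6 :=
      Finset.union_subset (sb _) (Finset.union_subset (sb _)
        (Finset.union_subset (sb _) (sb _)))
    have := Finset.card_le_card hs
    rw [hu] at this
    simp at this
  · refine hw_core (f a) (f b) (f c) (f d) (f e) (f g) (f z) (f l1) (f l2) (f l3)
      (f m1) (f m2) (f m3) (cd _) (cd _) (cd _) (cd _) (cd _) (cd _) (cd _) (cd _) (cd _)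
      (cd _) (cd _) (cd _) (cd _) ?_ AB AC BC
      (hw_disj hf u1) (hw_disj hf u2) (hw_disj hf u7)
      (hw_disj hf u3) (hw_disj hf u4) (hw_disj hf u8)
      (hw_disj hf u5) (hw_disj hf u6) (hw_disj hf u9)
      (hw_disj hf w1) (hw_disj hf w2) (hw_disj hf x1)
      (hw_disj hf w3) (hw_disj hf w4) (hw_disj hf x2)
      (hw_disj hf w5) (hw_disj hf w6) (hw_disj hf x3)
      (hw_ne hf y1 z1) (hw_ne hf y2 z2) (hw_ne hf y3 z3)
    simp only [List.mem_cons, List.not_mem_nil, or_false, forall_eq_or_imp, forall_eq]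
    exact ⟨sb _, sb _, sb _, sb _, sb _, sb _, sb _, sb _, sb _, sb _, sb _, sb _, sb _⟩
end
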